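/- Let n ≥ 5, m ≥ 1 and (n+4)/(n−4) < p < q_c(n), where q_c(n) = ∞ for n ≤ 12 and q_c(n) = ( n + 2 − √( n² + 4 − n√(n² − 8n + 32) ) ) / ( n − 6 − √( n² + 4 − n√(n² − 8n + 32) ) ) for n ≥ 13. Let ψ_1,…,ψ_m be C⁴ functions on the unit sphere S^{n−1} and set u_i(x) = |x|^{−4/(p−1)} ψ_i(x/|x|). If u = (u_1,…,u_m) satisfies Δ²u_i = |u|^{p−1} u_i on ℝⁿ ∖ {0} for each i and the stability inequality Σ_i ∫ |u|^{p−1} φ_i² + (p−1) Σ_{i,j} ∫ |u|^{p−3} u_i u_j φ_i φ_j ≤ Σ_i ∫ |Δφ_i|² holds for all φ_1,…,φ_m ∈ C_c^∞(ℝⁿ ∖ {0}), then ψ_i ≡ 0 for every i. -/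

import Mathlib

open MeasureTheory Metric Filter Real Set

noncomputable section

/-- `n`-dimensional Euclidean space. -/
abbrev Euc (n : ℕ) := EuclideanSpace ℝ (Fin n)

/-- Laplacian of a scalar function on Euclidean space. -/
def lap {n : ℕ} (f : Euc n → ℝ) (x : Euc n) : ℝ :=
  ∑ i : Fin n, iteratedFDeriv ℝ 2 f x ![EuclideanSpace.single i 1, EuclideanSpace.single i 1]

/-- Stability (quadratic form) inequality for the fourth order Lane–Emden system, tested
against families of smooth compactly supported functions whose supports lie in `S`:
`Σ_i ∫ |u|^{p−1} φ_i² + (p−1) Σ_{i,j} ∫ |u|^{p−3} u_i u_j φ_i φ_j ≤ Σ_i ∫ |Δφ_i|²`.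
(Since `‖u x‖ ^ (p−3)` is interpreted with `Real.rpow`, the term `|u|^{p−3} u_i u_j`
vanishes on the set where `u = 0`, for any `p > 1`.) -/
def Stable2 (n m : ℕ) (p : ℝ) (u : Euc n → EuclideanSpace ℝ (Fin m))
    (S : Set (Euc n)) : Prop :=
  ∀ φ : Fin m → Euc n → ℝ,
    (∀ i, ContDiff ℝ (⊤ : ℕ∞) (φ i)) → (∀ i, HasCompactSupport (φ i)) →
    (∀ i, tsupport (φ i) ⊆ S) →
    (∑ i, ∫ x, ‖u x‖ ^ (p - 1) * (φ i x) ^ 2) +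
      (p - 1) * ∑ i, ∑ j, ∫ x, ‖u x‖ ^ (p - 3) * u x i * u x j * φ i x * φ j x
      ≤ ∑ i, ∫ x, (lap (φ i) x) ^ 2

/-! ### The Joseph–Lundgren exponent -/

lemma critical_lt_of_sq_lt {n α p : ℝ} (hp : p * α = α + 4)
    (h : 4 * ((n - 6) / 2 - α) ^ 2 < n ^ 2 + 4 - n * √(n ^ 2 - 8 * n + 32)) (hn : 0 ≤ n) :
    n ^ 2 * (n - 4) ^ 2 / 16 < p * (α * (α + 2) * (n - 2 - α) * (n - 4 - α)) := by
  have hy : 0 ≤ n ^ 2 - 8 * n + 32 := by nlinarith [sq_nonneg (n - 4)]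
  set y := √(n ^ 2 - 8 * n + 32) with hydef
  have hy2 : y ^ 2 = n ^ 2 - 8 * n + 32 := Real.sq_sqrt hy
  have hy0 : 0 ≤ y := Real.sqrt_nonneg _
  set q := 4 * ((n - 6) / 2 - α) ^ 2 with hq
  have key : 0 < (n ^ 2 + 4 - n * y - q) * (n ^ 2 + 4 + n * y - q) := by
    apply mul_pos
    · linarith
    · nlinarith [mul_nonneg hn hy0]
  have e : p * (α * (α + 2) * (n - 2 - α) * (n - 4 - α)) =
      (α + 4) * ((α + 2) * (n - 2 - α) * (n - 4 - α)) := by rw [← hp]; ring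
  rw [e]
  have : (n ^ 2 + 4 - n * y - q) * (n ^ 2 + 4 + n * y - q)
      = (n ^ 2 + 4 - q) ^ 2 - n ^ 2 * (n ^ 2 - 8 * n + 32) := by rw [← hy2]; ring
  rw [this, hq] at key
  nlinarith [key]

/-- In the subcritical Joseph–Lundgren range, the Hardy–Rellich constant is dominated. -/
lemma hardyRellich_lt (n : ℕ) (hn : 5 ≤ n) (p : ℝ)
    (hp1 : ((n : ℝ) + 4) / ((n : ℝ) - 4) < p)
    (hp2 : 13 ≤ n →
      p < ((n : ℝ) + 2 -
            Real.sqrt ((n : ℝ) ^ 2 + 4 - (n : ℝ) * Real.sqrt ((n : ℝ) ^ 2 - 8 * n + 32))) /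
          ((n : ℝ) - 6 -
            Real.sqrt ((n : ℝ) ^ 2 + 4 - (n : ℝ) * Real.sqrt ((n : ℝ) ^ 2 - 8 * n + 32)))) :
    1 < p ∧ 4 / (p - 1) < ((n : ℝ) - 4) / 2 ∧
    (n : ℝ) ^ 2 * (n - 4) ^ 2 / 16 < p * (4 / (p - 1) * (4 / (p - 1) + 2) *
      (n - 2 - 4 / (p - 1)) * (n - 4 - 4 / (p - 1))) := by
  have hn' : (5 : ℝ) ≤ n := by exact_mod_cast hn
  rw [div_lt_iff₀ (by linarith)] at hp1
  have h1 : 1 < p := by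
    by_contra! h
    nlinarith
  have hα0 : 0 < 4 / (p - 1) := div_pos (by norm_num) (by linarith)
  have hα : 4 / (p - 1) < ((n : ℝ) - 4) / 2 := by
    rw [div_lt_iff₀ (by linarith)]; linarith
  have hpα : p * (4 / (p - 1)) = 4 / (p - 1) + 4 := by
    field_simp [(by linarith : p - 1 ≠ 0)]; ring
  refine ⟨h1, hα, critical_lt_of_sq_lt hpα ?_ (by linarith)⟩
  set α := 4 / (p - 1) with hαdef
  have hy : (0 : ℝ) ≤ (n : ℝ) ^ 2 - 8 * n + 32 := by nlinarith [sq_nonneg ((n : ℝ) - 4)]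
  set y := √((n : ℝ) ^ 2 - 8 * n + 32) with hydef
  have hy2 : y ^ 2 = (n : ℝ) ^ 2 - 8 * n + 32 := Real.sq_sqrt hy
  have hy0 : 0 ≤ y := Real.sqrt_nonneg _
  have hyn : y ≤ n := by
    rw [hydef]; apply Real.sqrt_le_iff.2; constructor <;> nlinarith
  have hX4 : 4 ≤ (n : ℝ) ^ 2 + 4 - n * y := by nlinarith
  set z := √((n : ℝ) ^ 2 + 4 - n * y) with hzdef
  have hz2 : z ^ 2 = (n : ℝ) ^ 2 + 4 - n * y := Real.sq_sqrt (by linarith)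
  have hz : 2 ≤ z := by rw [hzdef]; apply Real.le_sqrt_of_sq_le; linarith
  rw [← hz2]
  have hup : (n : ℝ) - 6 - z < 2 * α := by
    by_cases hneg : (n : ℝ) - 6 - z ≤ 0
    · linarith
    push Not at hneg
    have h13 : 13 ≤ n := by
      by_contra! h
      have : (n : ℝ) - 6 ≤ z := by
        rw [hzdef]
        apply Real.le_sqrt_of_sq_le
        have : n * y ≤ 12 * n - 32 := by
          rw [hydef]
          have : (n : ℝ) * √((n : ℝ) ^ 2 - 8 * n + 32) =
              √((n : ℝ) ^ 2 * ((n : ℝ) ^ 2 - 8 * n + 32)) := by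
            rw [Real.sqrt_mul (by positivity), Real.sqrt_sq (by positivity)]
          rw [this]
          apply Real.sqrt_le_iff.2
          interval_cases n <;> norm_num
        nlinarith
      linarith
    have := hp2 h13
    rw [lt_div_iff₀ hneg] at this
    rw [hαdef, mul_div_assoc', lt_div_iff₀ (by linarith)]
    linarith
  have hlow : -z < n - 6 - 2 * α := by linarith
  have : (n - 6 - 2 * α) ^ 2 < z ^ 2 := sq_lt_sq' hlow (by linarith)
  nlinarith

/-- The quadratic-form argument: the integrals on the sphere
`A = ∫ |Δu|²`, `B = ∫ u·Δu`, `C = ∫ |u|²`, `D = ∫ |u|^{p+1}` force `C ≤ 0`. -/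
lemma nonpos_of_sphere_relations {n α p A B C D : ℝ} (hα : 0 < α)
    (hα' : α < (n - 4) / 2) (hp : 1 < p)
    (hHR : n ^ 2 * (n - 4) ^ 2 / 16 < p * (α * (α + 2) * (n - 2 - α) * (n - 4 - α)))
    (hD : D = A - 2 * (n - 4 - 2 * α) * B)
    (hstab : p * D ≤ A + 2 * ((α - (n - 4) / 2) * (n / 2 - α)) * B
      + ((α - (n - 4) / 2) * (n / 2 - α)) ^ 2 * C)
    (hB : B ≤ -(α * (n - 2 - α)) * C)
    (hS : 0 ≤ A + 2 * (α * (n - 2 - α)) * B + (α * (n - 2 - α)) ^ 2 * C) : C ≤ 0 := by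
  by_contra! hC
  obtain ⟨a, ha⟩ : ∃ a, a = α * (n - 2 - α) := ⟨_, rfl⟩
  obtain ⟨b, hb⟩ : ∃ b, b = (α + 2) * (n - 4 - α) := ⟨_, rfl⟩
  have ha0 : 0 < a := by rw [ha]; apply mul_pos <;> linarith
  have hb0 : 0 < b := by rw [hb]; apply mul_pos <;> linarith
  have hκ : (α - (n - 4) / 2) * (n / 2 - α) = a - n * (n - 4) / 4 := by rw [ha]; ring
  have hab : -2 * (n - 4 - 2 * α) = a - b := by rw [ha, hb]; ring
  have hHR' : n ^ 2 * (n - 4) ^ 2 / 16 < p * (a * b) := by rw [ha, hb]; linarith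
  rw [← ha] at hB hS
  rw [hκ] at hstab
  obtain ⟨G, hG⟩ : ∃ G, G = -B - a * C := ⟨_, rfl⟩
  obtain ⟨S, hSS⟩ : ∃ S, S = A + 2 * a * B + a ^ 2 * C := ⟨_, rfl⟩
  have hD' : D = A + (a - b) * B := by rw [hD, ← hab]; ring
  have hBG : B = -G - a * C := by linarith
  have hAS : A = S + 2 * a * G + a ^ 2 * C := by rw [hSS, hBG]; ring
  have hG0 : 0 ≤ G := by linarith
  have hS0 : 0 ≤ S := by linarith
  have hk : 0 < n * (n - 4) / 2 := by apply div_pos (mul_pos _ _) <;> linarith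
  have hpab : n * (n - 4) / 2 < p * (a + b) := by
    apply lt_of_pow_lt_pow_left₀ 2 (by positivity)
    have : (n * (n - 4) / 2) ^ 2 = 4 * (n ^ 2 * (n - 4) ^ 2 / 16) := by ring
    have h2 : 0 ≤ p * (p * (a - b) ^ 2) := by positivity
    have h3 : 0 < p * (a * b) * (p - 1) := mul_pos (by positivity) (by linarith)
    rw [this]
    nlinarith
  have main : (p - 1) * S + (p * (a + b) - n * (n - 4) / 2) * G
      + (p * (a * b) - n ^ 2 * (n - 4) ^ 2 / 16) * C ≤ 0 := by
    rw [hD', hAS, hBG] at hstab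
    nlinarith
  have t1 : 0 ≤ (p - 1) * S := mul_nonneg (by linarith) hS0
  have t2 : 0 ≤ (p * (a + b) - n * (n - 4) / 2) * G := mul_nonneg (by linarith) hG0
  have t3 : 0 < (p * (a * b) - n ^ 2 * (n - 4) ^ 2 / 16) * C := mul_pos (by linarith) hC
  linarith

/-! ### Partial derivatives and the Laplacian -/

/-- The `i`-th partial derivative. -/
def pd {n : ℕ} (i : Fin n) (f : Euc n → ℝ) (x : Euc n) : ℝ :=
  fderiv ℝ f x (EuclideanSpace.single i 1)

lemma ContDiffAt.pd {n : ℕ} {k : WithTop ℕ∞} {f : Euc n → ℝ} {x : Euc n}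
    (h : ContDiffAt ℝ (k + 1) f x) (i : Fin n) : ContDiffAt ℝ k (pd i f) x :=
  h.fderiv_right_succ.clm_apply contDiffAt_const

lemma ContDiffAt.pd_one {n : ℕ} {f : Euc n → ℝ} {x : Euc n}
    (h : ContDiffAt ℝ 2 f x) (i : Fin n) : ContDiffAt ℝ 1 (_root_.pd i f) x :=
  ContDiffAt.pd (k := 1) (by simpa [one_add_one_eq_two] using h) i

lemma ContDiffAt.pd_zero {n : ℕ} {f : Euc n → ℝ} {x : Euc n}
    (h : ContDiffAt ℝ 1 f x) (i : Fin n) : ContDiffAt ℝ 0 (_root_.pd i f) x :=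
  ContDiffAt.pd (k := 0) (by simpa using h) i

lemma pd_congr {n : ℕ} {f g : Euc n → ℝ} {x : Euc n} (h : f =ᶠ[nhds x] g) (i : Fin n) :
    pd i f x = pd i g x := by
  rw [pd, pd, h.fderiv_eq]

lemma pd_mul {n : ℕ} {f g : Euc n → ℝ} {x : Euc n} (hf : DifferentiableAt ℝ f x)
    (hg : DifferentiableAt ℝ g x) (i : Fin n) :
    pd i (fun y => f y * g y) x = f x * pd i g x + g x * pd i f x := by
  simp [pd, fderiv_fun_mul hf hg]

lemma pd_add {n : ℕ} {f g : Euc n → ℝ} {x : Euc n} (hf : DifferentiableAt ℝ f x)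
    (hg : DifferentiableAt ℝ g x) (i : Fin n) :
    pd i (fun y => f y + g y) x = pd i f x + pd i g x := by
  simp [pd, fderiv_fun_add hf hg]

lemma pd_coord {n : ℕ} (i : Fin n) (x : Euc n) : pd i (fun y => y i) x = 1 := by
  have : HasFDerivAt (fun y : Euc n => y i) (EuclideanSpace.proj (𝕜 := ℝ) i) x :=
    (EuclideanSpace.proj (𝕜 := ℝ) i).hasFDerivAt
  simp [pd, this.fderiv]

lemma lap_eq_sum_pd {n : ℕ} {f : Euc n → ℝ} {x : Euc n} (h : ContDiffAt ℝ 2 f x) :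
    lap f x = ∑ i, pd i (pd i f) x := by
  refine Finset.sum_congr rfl fun i _ => ?_
  have hd : DifferentiableAt ℝ (fderiv ℝ f) x :=
    (h.fderiv_right (m := 1) (by norm_num [one_add_one_eq_two])).differentiableAt one_ne_zero
  rw [iteratedFDeriv_two_apply]
  change _ = fderiv ℝ (fun y => fderiv ℝ f y _) x _
  rw [fderiv_clm_apply hd (differentiableAt_const _)]
  simp

lemma ContDiffAt.eventually_two {n : ℕ} {f : Euc n → ℝ} {x : Euc n} (h : ContDiffAt ℝ 2 f x) :
    ∀ᶠ y in nhds x, ContDiffAt ℝ 2 f y :=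
  h.eventually (by simp)

lemma ContDiffAt.lap {n : ℕ} {k : WithTop ℕ∞} {f : Euc n → ℝ} {x : Euc n}
    (h : ContDiffAt ℝ (k + 1 + 1) f x) : ContDiffAt ℝ k (_root_.lap f) x := by
  have h2 : ContDiffAt ℝ 2 f x := h.of_le (by
    rw [← one_add_one_eq_two]; gcongr; exact le_add_self)
  have : _root_.lap f =ᶠ[nhds x] fun y => ∑ i, _root_.pd i (_root_.pd i f) y :=
    h2.eventually_two.mono fun y hy => lap_eq_sum_pd hy
  refine ContDiffAt.congr_of_eventuallyEq ?_ this
  exact ContDiffAt.sum fun i _ => (h.pd i).pd i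

lemma pd_pd_mul {n : ℕ} {f g : Euc n → ℝ} {x : Euc n} (hf : ContDiffAt ℝ 2 f x)
    (hg : ContDiffAt ℝ 2 g x) (i : Fin n) :
    pd i (pd i fun y => f y * g y) x =
      f x * pd i (pd i g) x + 2 * (pd i f x * pd i g x) + g x * pd i (pd i f) x := by
  have h : pd i (fun y => f y * g y) =ᶠ[nhds x] fun y => f y * pd i g y + g y * pd i f y := by
    filter_upwards [hf.eventually_two, hg.eventually_two] with y h1 h2
    exact pd_mul (h1.differentiableAt two_ne_zero) (h2.differentiableAt two_ne_zero) i
  have df := hf.differentiableAt two_ne_zero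
  have dg := hg.differentiableAt two_ne_zero
  have df' := (hf.pd_one i).differentiableAt one_ne_zero
  have dg' := (hg.pd_one i).differentiableAt one_ne_zero
  rw [pd_congr h, pd_add (df.fun_mul dg') (dg.fun_mul df'), pd_mul df dg', pd_mul dg df']
  ring

lemma lap_mul {n : ℕ} {f g : Euc n → ℝ} {x : Euc n} (hf : ContDiffAt ℝ 2 f x)
    (hg : ContDiffAt ℝ 2 g x) :
    lap (fun y => f y * g y) x =
      f x * lap g x + 2 * ∑ i, pd i f x * pd i g x + g x * lap f x := by
  rw [lap_eq_sum_pd (hf.mul hg), lap_eq_sum_pd hf, lap_eq_sum_pd hg, Finset.mul_sum,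
    Finset.mul_sum, Finset.mul_sum, ← Finset.sum_add_distrib, ← Finset.sum_add_distrib]
  exact Finset.sum_congr rfl fun i _ => pd_pd_mul hf hg i

/-! ### Homogeneous functions -/

lemma euler_identity {n : ℕ} {f : Euc n → ℝ} {δ : ℝ} {x : Euc n} (hf : DifferentiableAt ℝ f x)
    (hhom : ∀ t : ℝ, 0 < t → f (t • x) = t ^ δ * f x) :
    ∑ i, x i * pd i f x = δ * f x := by
  have h1 : HasDerivAt (fun t : ℝ => f (t • x)) (fderiv ℝ f x x) 1 := by
    have hs : HasDerivAt (fun t : ℝ => t • x) x 1 := by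
      simpa using (hasDerivAt_id (1 : ℝ)).smul_const x
    have hf' : HasFDerivAt f (fderiv ℝ f x) ((1 : ℝ) • x) := by simpa using hf.hasFDerivAt
    exact hf'.comp_hasDerivAt 1 hs
  have h2 : HasDerivAt (fun t : ℝ => f (t • x)) (δ * f x) 1 := by
    have : HasDerivAt (fun t : ℝ => t ^ δ * f x) (δ * f x) 1 := by
      simpa using ((Real.hasDerivAt_rpow_const (x := 1) (p := δ) (Or.inl one_ne_zero)).mul_const
        (f x))
    refine this.congr_of_eventuallyEq ?_
    filter_upwards [lt_mem_nhds (zero_lt_one (α := ℝ))] with t ht using hhom t ht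
  rw [← h1.unique h2]
  conv_rhs => rw [← (EuclideanSpace.basisFun (Fin n) ℝ).sum_repr x, map_sum,
    (EuclideanSpace.basisFun (Fin n) ℝ).sum_repr x]
  refine Finset.sum_congr rfl fun i _ => ?_
  simp [pd]

lemma pd_homogeneous {n : ℕ} {f : Euc n → ℝ} {δ : ℝ}
    (hhom : ∀ t : ℝ, 0 < t → ∀ x : Euc n, x ≠ 0 → f (t • x) = t ^ δ * f x) (i : Fin n) :
    ∀ t : ℝ, 0 < t → ∀ x : Euc n, x ≠ 0 → pd i f (t • x) = t ^ (δ - 1) * pd i f x := by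
  intro t ht x hx
  have h1 : pd i (fun y => f (t • y)) x = t * pd i f (t • x) := by
    simp only [pd]
    rw [fderiv_comp_smul]; simp
  have h2 : pd i (fun y => f (t • y)) x = t ^ δ * pd i f x := by
    rw [pd_congr (g := t ^ δ • f)]
    · simp only [pd]
      rw [fderiv_const_smul_field]; simp
    · filter_upwards [isOpen_ne.mem_nhds hx] with y hy using hhom t ht y hy
  rw [Real.rpow_sub_one ht.ne', div_mul_eq_mul_div, eq_div_iff ht.ne', ← h2, h1, mul_comm]

lemma lap_homogeneous {n : ℕ} {f : Euc n → ℝ} {δ : ℝ}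
    (hf : ∀ x : Euc n, x ≠ 0 → ContDiffAt ℝ 2 f x)
    (hhom : ∀ t : ℝ, 0 < t → ∀ x : Euc n, x ≠ 0 → f (t • x) = t ^ δ * f x) :
    ∀ t : ℝ, 0 < t → ∀ x : Euc n, x ≠ 0 → lap f (t • x) = t ^ (δ - 2) * lap f x := by
  intro t ht x hx
  rw [lap_eq_sum_pd (hf x hx), lap_eq_sum_pd (hf _ (smul_ne_zero ht.ne' hx)), Finset.mul_sum]
  refine Finset.sum_congr rfl fun i _ => ?_
  rw [pd_homogeneous (pd_homogeneous hhom i) i t ht x hx]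
  ring_nf

/-! ### Test functions supported away from the origin -/

/-- Compactly supported `C^k` functions whose support avoids the origin. -/
structure IsTest {n : ℕ} (k : WithTop ℕ∞) (f : Euc n → ℝ) : Prop where
  contDiff : ContDiff ℝ k f
  hasCompactSupport : HasCompactSupport f
  zero_notMem : (0 : Euc n) ∉ tsupport f

namespace IsTest

variable {n : ℕ} {k : WithTop ℕ∞} {f h : Euc n → ℝ}

lemma of_le {l : WithTop ℕ∞} (hf : IsTest k f) (hl : l ≤ k) : IsTest l f :=
  ⟨hf.contDiff.of_le hl, hf.hasCompactSupport, hf.zero_notMem⟩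

lemma mul_right (hf : IsTest k f) (hh : ∀ x : Euc n, x ≠ 0 → ContDiffAt ℝ k h x) :
    IsTest k (fun x => f x * h x) where
  contDiff := by
    rw [contDiff_iff_contDiffAt]
    intro x
    by_cases hx : x = 0
    · subst hx
      refine contDiffAt_const.congr_of_eventuallyEq (f := fun _ => (0 : ℝ)) ?_
      filter_upwards [notMem_tsupport_iff_eventuallyEq.1 hf.zero_notMem] with y hy
      simp [hy]
    · exact hf.contDiff.contDiffAt.mul (hh x hx)
  hasCompactSupport := hf.hasCompactSupport.mul_right
  zero_notMem h0 := hf.zero_notMem (tsupport_mul_subset_left h0)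

lemma mul_left (hf : IsTest k f) (hh : ∀ x : Euc n, x ≠ 0 → ContDiffAt ℝ k h x) :
    IsTest k (fun x => h x * f x) := by
  simpa only [mul_comm] using hf.mul_right hh

lemma integrable (hf : IsTest k f) : Integrable f :=
  hf.contDiff.continuous.integrable_of_hasCompactSupport hf.hasCompactSupport

lemma integrable_mul (hf : IsTest k f) (hh : ∀ x : Euc n, x ≠ 0 → ContDiffAt ℝ 0 h x) :
    Integrable (fun x => f x * h x) :=
  ((hf.of_le zero_le).mul_right hh).integrable

lemma pd (hf : IsTest (k + 1) f) (i : Fin n) : IsTest k (_root_.pd i f) where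
  contDiff := contDiff_iff_contDiffAt.2 fun _ => hf.contDiff.contDiffAt.pd i
  hasCompactSupport := hf.hasCompactSupport.fderiv_apply ℝ _
  zero_notMem h0 := hf.zero_notMem (tsupport_fderiv_apply_subset ℝ _ h0)

/-- Green's second identity, for a compactly supported test function. -/
lemma integral_mul_lap (hf : IsTest 2 f) (hh : ∀ x : Euc n, x ≠ 0 → ContDiffAt ℝ 2 h x) :
    ∫ x, f x * lap h x = ∫ x, lap f x * h x := by
  have ne0 : ∀ {x : Euc n} {g : Euc n → ℝ}, IsTest 0 g → x ∈ tsupport g → x ≠ 0 := by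
    rintro x g hg hx rfl; exact hg.zero_notMem hx
  have hf0 : IsTest 0 f := hf.of_le zero_le
  have hf1 : ∀ i, IsTest 1 (_root_.pd i f) := fun i =>
    IsTest.pd (k := 1) (by simpa [one_add_one_eq_two] using hf) i
  have hf2 : ∀ i, IsTest 0 (_root_.pd i (_root_.pd i f)) := fun i =>
    IsTest.pd (k := 0) (by simpa using hf1 i) i
  have hf1' : ∀ i, IsTest 0 (_root_.pd i f) := fun i => (hf1 i).of_le zero_le
  have hh0 : ∀ x : Euc n, x ≠ 0 → ContDiffAt ℝ 0 h x := fun x hx => (hh x hx).of_le zero_le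
  have hh1 : ∀ i, ∀ x : Euc n, x ≠ 0 → ContDiffAt ℝ 0 (_root_.pd i h) x := fun i x hx =>
    ((hh x hx).pd_one i).of_le zero_le
  have hh2 : ∀ i, ∀ x : Euc n, x ≠ 0 → ContDiffAt ℝ 0 (_root_.pd i (_root_.pd i h)) x :=
    fun i x hx => ((hh x hx).pd_one i).pd_zero i
  have e1 : ∫ x, f x * lap h x = ∫ x, ∑ i, f x * _root_.pd i (_root_.pd i h) x := by
    refine integral_congr_ae (Eventually.of_forall fun x => ?_)
    by_cases hx : x = 0
    · subst hx; simp [image_eq_zero_of_notMem_tsupport hf.zero_notMem]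
    · simp only [lap_eq_sum_pd (hh x hx), Finset.mul_sum]
  have e2 : ∫ x, lap f x * h x = ∫ x, ∑ i, _root_.pd i (_root_.pd i f) x * h x := by
    refine integral_congr_ae (Eventually.of_forall fun x => ?_)
    simp only [lap_eq_sum_pd hf.contDiff.contDiffAt, Finset.sum_mul]
  rw [e1, e2, integral_finsetSum _ fun i _ => hf0.integrable_mul (hh2 i),
    integral_finsetSum _ fun i _ => (hf2 i).integrable_mul hh0]
  refine Finset.sum_congr rfl fun i _ => ?_
  have s1 : ∫ x, f x * _root_.pd i (_root_.pd i h) x = - ∫ x, _root_.pd i f x * _root_.pd i h x :=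
    integral_mul_fderiv_eq_neg_fderiv_mul_of_integrable
      ((hf1' i).integrable_mul (hh1 i)) (hf0.integrable_mul (hh2 i)) (hf0.integrable_mul (hh1 i))
      (fun x _ => hf.contDiff.contDiffAt.differentiableAt two_ne_zero)
      (fun x hx => ((hh x (ne0 hf0 hx)).pd_one i).differentiableAt one_ne_zero)
  have s2 : ∫ x, _root_.pd i f x * _root_.pd i h x = - ∫ x, _root_.pd i (_root_.pd i f) x * h x :=
    integral_mul_fderiv_eq_neg_fderiv_mul_of_integrable
      ((hf2 i).integrable_mul hh0) ((hf1' i).integrable_mul (hh1 i)) ((hf1' i).integrable_mul hh0)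
      (fun x _ => (hf1 i).contDiff.contDiffAt.differentiableAt one_ne_zero)
      (fun x hx => (hh x (ne0 (hf1' i) hx)).differentiableAt two_ne_zero)
  rw [s1, s2, neg_neg]

end IsTest

lemma two_le_infty : (2 : WithTop ℕ∞) ≤ ((⊤ : ℕ∞) : WithTop ℕ∞) :=
  WithTop.coe_le_coe.2 (le_top : (2 : ℕ∞) ≤ ⊤)

/-! ### Radial test functions -/

/-- The radial function `|x|^γ ζ(log |x|)`, extended by zero at the origin. -/
def radial {n : ℕ} (γ : ℝ) (ζ : ℝ → ℝ) (x : Euc n) : ℝ :=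
  if x = 0 then 0 else ‖x‖ ^ γ * ζ (log ‖x‖)

/-- The operator on profiles corresponding to the radial derivative: `r ∂_r (r^γ ζ(log r))` is
`r^γ` times `(eulerOp γ ζ)(log r)`. -/
def eulerOp (γ : ℝ) (ζ : ℝ → ℝ) (t : ℝ) : ℝ := γ * ζ t + deriv ζ t

lemma ContDiff.eulerOp {γ : ℝ} {ζ : ℝ → ℝ} (hζ : ContDiff ℝ (⊤ : ℕ∞) ζ) :
    ContDiff ℝ (⊤ : ℕ∞) (eulerOp γ ζ) :=
  (contDiff_const.mul hζ).add (contDiff_infty_iff_deriv.1 hζ).2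

lemma radial_apply {n : ℕ} {γ : ℝ} {ζ : ℝ → ℝ} {x : Euc n} (hx : x ≠ 0) :
    radial γ ζ x = ‖x‖ ^ γ * ζ (log ‖x‖) := if_neg hx

lemma radial_mul_radial {n : ℕ} (γ γ' : ℝ) (ζ ζ' : ℝ → ℝ) (x : Euc n) :
    radial γ ζ x * radial γ' ζ' x = radial (γ + γ') (fun t => ζ t * ζ' t) x := by
  by_cases hx : x = 0
  · simp [radial, hx]
  · rw [radial_apply hx, radial_apply hx, radial_apply hx, Real.rpow_add (norm_pos_iff.2 hx)]
    ring

lemma contDiffAt_radial {n : ℕ} {k : ℕ∞} {γ : ℝ} {ζ : ℝ → ℝ} (hζ : ContDiff ℝ k ζ)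
    {x : Euc n} (hx : x ≠ 0) : ContDiffAt ℝ k (radial γ ζ) x := by
  have h0 : ‖x‖ ≠ 0 := norm_ne_zero_iff.2 hx
  have hn : ContDiffAt ℝ k (fun y : Euc n => ‖y‖) x := contDiffAt_norm ℝ hx
  have : radial γ ζ =ᶠ[nhds x] fun y => ‖y‖ ^ γ * ζ (log ‖y‖) := by
    filter_upwards [isOpen_ne.mem_nhds hx] with y hy using radial_apply hy
  exact ((hn.rpow_const_of_ne h0).mul
    (hζ.contDiffAt.comp x (hn.log h0))).congr_of_eventuallyEq this

lemma isTest_radial {n : ℕ} {k : ℕ∞} (γ : ℝ) {ζ : ℝ → ℝ} (hζ : ContDiff ℝ k ζ)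
    (hc : HasCompactSupport ζ) : IsTest k (radial (n := n) γ ζ) := by
  obtain ⟨R, hR, hR'⟩ := hc.exists_pos_le_norm
  have hsupp : Function.support (radial (n := n) γ ζ) ⊆
      {x | exp (-R) ≤ ‖x‖} ∩ closedBall 0 (exp R) := by
    intro x hx
    have hx0 : x ≠ 0 := by rintro rfl; simp [radial] at hx
    rw [Function.mem_support, radial_apply hx0] at hx
    have hlog : |log ‖x‖| < R := by
      by_contra! h
      exact hx (by rw [hR' _ h, mul_zero])
    rw [abs_lt] at hlog
    have hpos := norm_pos_iff.2 hx0
    constructor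
    · exact (Real.le_log_iff_exp_le hpos).1 hlog.1.le
    · simpa using (Real.log_le_iff_le_exp hpos).1 hlog.2.le
  have hclosed : IsClosed {x : Euc n | exp (-R) ≤ ‖x‖} :=
    isClosed_le continuous_const continuous_norm
  have hcomp : IsCompact ({x : Euc n | exp (-R) ≤ ‖x‖} ∩ closedBall 0 (exp R)) :=
    (isCompact_closedBall _ _).inter_left hclosed
  have hts := closure_minimal hsupp hcomp.isClosed
  have hzero : (0 : Euc n) ∉ tsupport (radial (n := n) γ ζ) := by
    intro h
    have := (hts h).1
    simp only [mem_ofPred_eq, norm_zero] at this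
    exact absurd this (not_le.2 (exp_pos _))
  refine ⟨?_, HasCompactSupport.of_support_subset_isCompact hcomp hsupp, hzero⟩
  rw [contDiff_iff_contDiffAt]
  intro x
  by_cases hx : x = 0
  · subst hx
    exact contDiffAt_const.congr_of_eventuallyEq (notMem_tsupport_iff_eventuallyEq.1 hzero)
  · exact contDiffAt_radial hζ hx

lemma pd_radial {n : ℕ} {γ : ℝ} {ζ : ℝ → ℝ} (hζ : Differentiable ℝ ζ) {x : Euc n} (hx : x ≠ 0)
    (i : Fin n) : pd i (radial γ ζ) x = x i * radial (γ - 2) (eulerOp γ ζ) x := by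
  have hpos := norm_pos_iff.2 hx
  have e : radial γ ζ =ᶠ[nhds x]
      (fun s : ℝ => s ^ (γ / 2) * ζ (log s / 2)) ∘ fun y : Euc n => ‖y‖ ^ 2 := by
    filter_upwards [isOpen_ne.mem_nhds hx] with y hy
    have hy' := norm_pos_iff.2 hy
    rw [radial_apply hy, Function.comp_apply, ← Real.rpow_natCast, ← Real.rpow_mul hy'.le,
      Real.log_rpow hy']
    congr 2
    · push_cast; ring
    · push_cast; ring
  have h2 : HasDerivAt (fun s : ℝ => s ^ (γ / 2) * ζ (log s / 2))
      ((γ / 2 * (‖x‖ ^ 2) ^ (γ / 2 - 1)) * ζ (log (‖x‖ ^ 2) / 2) +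
        (‖x‖ ^ 2) ^ (γ / 2) * (deriv ζ (log (‖x‖ ^ 2) / 2) * ((‖x‖ ^ 2)⁻¹ / 2))) (‖x‖ ^ 2) := by
    have hs : ‖x‖ ^ 2 ≠ 0 := by positivity
    refine (Real.hasDerivAt_rpow_const (Or.inl hs)).mul ?_
    exact (hζ _).hasDerivAt.comp (‖x‖ ^ 2) ((Real.hasDerivAt_log hs).div_const 2)
  have h3 : HasFDerivAt (fun y : Euc n => ‖y‖ ^ 2) (2 • innerSL ℝ x) x :=
    (hasStrictFDerivAt_norm_sq x).hasFDerivAt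
  rw [pd_congr e, pd, (h2.comp_hasFDerivAt x h3).fderiv, radial_apply hx]
  have hlog : log (‖x‖ ^ 2) / 2 = log ‖x‖ := by rw [Real.log_pow]; push_cast; ring
  have hr1 : (‖x‖ ^ 2) ^ (γ / 2 - 1) = ‖x‖ ^ (γ - 2) := by
    rw [← Real.rpow_natCast, ← Real.rpow_mul hpos.le]; congr 1; push_cast; ring
  have hr2 : (‖x‖ ^ 2) ^ (γ / 2) * (‖x‖ ^ 2)⁻¹ = ‖x‖ ^ (γ - 2) := by
    rw [← hr1, Real.rpow_sub_one (by positivity), ← div_eq_mul_inv]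
  rw [hlog, hr1]
  have hin : inner ℝ x (EuclideanSpace.single i (1 : ℝ)) = x i := by
    simp [EuclideanSpace.inner_single_right]
  simp only [smul_apply, innerSL_apply_apply, hin, smul_eq_mul, nsmul_eq_mul, eulerOp]
  push_cast
  linear_combination (x i * deriv ζ (log ‖x‖)) * hr2

lemma lap_radial {n : ℕ} {γ : ℝ} {ζ : ℝ → ℝ} (hζ : ContDiff ℝ (⊤ : ℕ∞) ζ) {x : Euc n}
    (hx : x ≠ 0) :
    lap (radial γ ζ) x = radial (γ - 2) (eulerOp (n + γ - 2) (eulerOp γ ζ)) x := by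
  have hpos := norm_pos_iff.2 hx
  have hd : ∀ {ξ : ℝ → ℝ}, ContDiff ℝ (⊤ : ℕ∞) ξ → Differentiable ℝ ξ :=
    fun h => h.differentiable (by simp)
  have h1 := hd hζ
  have h2 := hd (hζ.eulerOp (γ := γ))
  rw [lap_eq_sum_pd ((contDiffAt_radial hζ hx).of_le two_le_infty)]
  have key : ∀ i, pd i (pd i (radial γ ζ)) x = radial (γ - 2) (eulerOp γ ζ) x +
      x i ^ 2 * radial (γ - 2 - 2) (eulerOp (γ - 2) (eulerOp γ ζ)) x := by
    intro i
    have e : pd i (radial γ ζ) =ᶠ[nhds x] fun y => y i * radial (γ - 2) (eulerOp γ ζ) y := by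
      filter_upwards [isOpen_ne.mem_nhds hx] with y hy using pd_radial h1 hy i
    have dr : DifferentiableAt ℝ (radial (n := n) (γ - 2) (eulerOp γ ζ)) x :=
      (contDiffAt_radial hζ.eulerOp hx).differentiableAt (by simp)
    rw [pd_congr e, pd_mul (by fun_prop) dr, pd_coord, pd_radial h2 hx]
    ring
  have hsq : ∑ i, x i ^ 2 = ‖x‖ ^ 2 := by rw [EuclideanSpace.real_norm_sq_eq]
  rw [Finset.sum_congr rfl fun i _ => key i, Finset.sum_add_distrib, ← Finset.sum_mul, hsq]
  simp only [Finset.sum_const, Finset.card_univ, Fintype.card_fin, nsmul_eq_mul,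
    radial_apply hx]
  have hr : ‖x‖ ^ 2 * ‖x‖ ^ (γ - 2 - 2) = ‖x‖ ^ (γ - 2) := by
    rw [← Real.rpow_natCast, ← Real.rpow_add hpos]; congr 1; push_cast; ring
  simp only [eulerOp]
  linear_combination ((γ - 2) * (γ * ζ (log ‖x‖) + deriv ζ (log ‖x‖)) +
    deriv (eulerOp γ ζ) (log ‖x‖)) * hr

lemma lap_radial_mul {n : ℕ} {γ δ : ℝ} {ζ : ℝ → ℝ} (hζ : ContDiff ℝ (⊤ : ℕ∞) ζ) {x : Euc n}
    (hx : x ≠ 0) {g : Euc n → ℝ} (hg : ContDiffAt ℝ 2 g x)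
    (heuler : ∑ i, x i * pd i g x = δ * g x) :
    lap (fun y => radial γ ζ y * g y) x = radial γ ζ x * lap g x +
      radial (γ - 2) (eulerOp (n + γ - 2 + 2 * δ) (eulerOp γ ζ)) x * g x := by
  have h2 : ContDiffAt ℝ 2 (radial (n := n) γ ζ) x :=
    (contDiffAt_radial hζ hx).of_le two_le_infty
  rw [lap_mul h2 hg, lap_radial hζ hx]
  have : ∑ i, pd i (radial γ ζ) x * pd i g x =
      radial (γ - 2) (eulerOp γ ζ) x * (δ * g x) := by
    rw [← heuler, Finset.mul_sum]
    refine Finset.sum_congr rfl fun i _ => ?_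
    rw [pd_radial (hζ.differentiable (by simp)) hx]
    ring
  rw [this]
  simp only [radial_apply hx, eulerOp]
  ring

/-! ### Polar coordinates -/

/-- The integral over the unit sphere. -/
def sphereIntegral {n : ℕ} (w : Euc n → ℝ) : ℝ :=
  ∫ y : sphere (0 : Euc n) 1, w y ∂(volume : Measure (Euc n)).toSphere

lemma integral_Ioi_inv_mul_comp_log (ζ : ℝ → ℝ) :
    ∫ r in Ioi (0 : ℝ), r⁻¹ * ζ (log r) = ∫ t, ζ t := by
  have := integral_image_eq_integral_abs_deriv_smul (s := univ) MeasurableSet.univ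
    (fun x _ => (Real.hasDerivAt_exp x).hasDerivWithinAt)
    (fun x _ y _ hxy => Real.exp_injective hxy) (fun r => r⁻¹ * ζ (log r))
  rw [image_univ, Real.range_exp] at this
  rw [this, setIntegral_univ]
  refine integral_congr_ae (Eventually.of_forall fun t => ?_)
  simp [abs_of_pos (Real.exp_pos t), (Real.exp_pos t).ne']

lemma integral_radial_mul {n : ℕ} (hn : 1 ≤ n) {γ δ : ℝ} (ζ : ℝ → ℝ) {w : Euc n → ℝ}
    (hw : ∀ t : ℝ, 0 < t → ∀ x : Euc n, x ≠ 0 → w (t • x) = t ^ δ * w x)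
    (hdeg : γ + δ + n = 0) :
    ∫ x, radial γ ζ x * w x = sphereIntegral w * ∫ t, ζ t := by
  have : Nontrivial (Euc n) :=
    Module.nontrivial_of_finrank_pos (R := ℝ) (by rw [finrank_euclideanSpace_fin]; omega)
  set G : ℝ → ℝ := fun r => r ^ (γ + δ) * ζ (log r) with hG
  calc
    ∫ x, radial γ ζ x * w x
      = ∫ x : ({(0)}ᶜ : Set (Euc n)), radial γ ζ x.1 * w x.1 ∂(volume.comap Subtype.val) := by
        rw [integral_subtype_comap (measurableSet_singleton _).compl
          fun x : Euc n => radial γ ζ x * w x, restrict_compl_singleton]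
    _ = ∫ z : sphere (0 : Euc n) 1 × Ioi (0 : ℝ), w z.1 * G z.2
        ∂(volume : Measure (Euc n)).toSphere.prod (.volumeIoiPow (Module.finrank ℝ (Euc n) - 1)) := by
        rw [← (volume : Measure (Euc n)).measurePreserving_homeomorphUnitSphereProd.integral_comp
          (Homeomorph.measurableEmbedding _)]
        refine integral_congr_ae (Eventually.of_forall fun x => ?_)
        have hx : (x : Euc n) ≠ 0 := x.2
        have hpos := norm_pos_iff.2 hx
        have hwx := hw ‖(x : Euc n)‖ hpos (‖(x : Euc n)‖⁻¹ • (x : Euc n))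
          (smul_ne_zero (inv_ne_zero hpos.ne') hx)
        rw [smul_inv_smul₀ hpos.ne'] at hwx
        simp only [homeomorphUnitSphereProd_apply_fst_coe, homeomorphUnitSphereProd_apply_snd_coe,
          hG, radial_apply hx]
        rw [hwx, Real.rpow_add hpos]
        ring
    _ = sphereIntegral w * ∫ r : Ioi (0 : ℝ), G r
        ∂.volumeIoiPow (Module.finrank ℝ (Euc n) - 1) :=
        integral_prod_mul (fun y : sphere (0 : Euc n) 1 => w y) (fun r : Ioi (0 : ℝ) => G r)
    _ = sphereIntegral w * ∫ t, ζ t := by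
        congr 1
        rw [← integral_Ioi_inv_mul_comp_log]
        simp only [Measure.volumeIoiPow, ENNReal.ofReal]
        rw [integral_withDensity_eq_integral_smul,
          integral_subtype_comap measurableSet_Ioi fun a ↦
            Real.toNNReal (a ^ (Module.finrank ℝ (Euc n) - 1)) • G a,
          setIntegral_congr_fun measurableSet_Ioi fun r hr ↦ ?_]
        · have hr : 0 < r := hr
          simp only [finrank_euclideanSpace_fin]
          rw [NNReal.smul_def, Real.coe_toNNReal _ (pow_nonneg hr.le _), hG, smul_eq_mul,
            ← mul_assoc, ← Real.rpow_natCast, ← Real.rpow_add hr, ← Real.rpow_neg_one]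
          congr 2
          push_cast [Nat.cast_sub hn]
          linarith
        · exact (measurable_subtype_coe.pow_const _).real_toNNReal

lemma integral_eulerOp {γ : ℝ} {ζ : ℝ → ℝ} (hζ : ContDiff ℝ (⊤ : ℕ∞) ζ)
    (hc : HasCompactSupport ζ) : ∫ t, eulerOp γ ζ t = γ * ∫ t, ζ t := by
  have i1 : Integrable ζ := hζ.continuous.integrable_of_hasCompactSupport hc
  have i2 : Integrable (deriv ζ) :=
    (contDiff_infty_iff_deriv.1 hζ).2.continuous.integrable_of_hasCompactSupport hc.deriv
  have hz : ∫ t, deriv ζ t = 0 :=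
    integral_eq_zero_of_hasDerivAt_of_integrable
      (fun t => (hζ.differentiable (by simp) t).hasDerivAt) i2 i1
  simp only [eulerOp]
  rw [integral_add (i1.const_mul γ) i2, hz, add_zero, integral_const_mul]

lemma HasCompactSupport.eulerOp {γ : ℝ} {ζ : ℝ → ℝ} (hc : HasCompactSupport ζ) :
    HasCompactSupport (eulerOp γ ζ) :=
  (hc.mul_left (f := fun _ => γ)).add hc.deriv

/-! ### Mollification of test functions -/

section Mollification

open scoped Convolution Topology

open ContinuousLinearMap (lsmul)

lemma abs_normed_convolution_le {n : ℕ} (ρ : ContDiffBump (0 : Euc n)) {g : Euc n → ℝ} {M : ℝ}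
    (hg : Continuous g) (hM : ∀ x, |g x| ≤ M) (x : Euc n) :
    |(ρ.normed volume ⋆[lsmul ℝ ℝ, volume] g) x| ≤ M := by
  have h := dist_convolution_le (μ := volume) (f := ρ.normed volume) (g := g)
    (x₀ := x) (z₀ := (0 : ℝ)) (ε := M) (R := ρ.rOut) ((abs_nonneg _).trans (hM x))
    ρ.support_normed_eq.subset ρ.nonneg_normed ρ.integral_normed hg.aestronglyMeasurable
    (fun y _ => by simpa using hM y)
  simpa using h

lemma pd_normed_convolution {n : ℕ} (ρ : ContDiffBump (0 : Euc n)) {g : Euc n → ℝ}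
    (hg : ContDiff ℝ 1 g) (hc : HasCompactSupport g) (i : Fin n) :
    pd i (ρ.normed volume ⋆[lsmul ℝ ℝ, volume] g) =
      (ρ.normed volume ⋆[lsmul ℝ ℝ, volume] pd i g) := by
  ext x
  have hρ : LocallyIntegrable (ρ.normed (volume : Measure (Euc n))) volume :=
    ρ.continuous_normed.locallyIntegrable
  rw [pd, (hc.hasFDerivAt_convolution_right (lsmul ℝ ℝ) hρ hg x).fderiv,
    convolution_precompR_apply (lsmul ℝ ℝ) hρ (hc.fderiv ℝ) (hg.continuous_fderiv (by simp))]
  rfl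

/-- A `C²` test function is a limit of smooth ones, together with its Laplacian, boundedly and
with supports in a fixed compact set. -/
lemma exists_smooth_approx {n : ℕ} {f : Euc n → ℝ} (hf : IsTest 2 f) :
    ∃ (F : ℕ → Euc n → ℝ) (K : Set (Euc n)) (M : ℝ), IsCompact K ∧ (0 : Euc n) ∉ K ∧
      (∀ k, ContDiff ℝ (⊤ : ℕ∞) (F k)) ∧ (∀ k, tsupport (F k) ⊆ K) ∧
      (∀ k x, |F k x| ≤ M) ∧ (∀ k x, |lap (F k) x| ≤ M) ∧
      (∀ x, Tendsto (fun k => F k x) atTop (𝓝 (f x))) ∧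
      (∀ x, Tendsto (fun k => lap (F k) x) atTop (𝓝 (lap f x))) := by
  obtain ⟨δ, hδ, hK⟩ := hf.hasCompactSupport.isCompact.exists_cthickening_subset_open
    (isOpen_compl_singleton (x := (0 : Euc n))) (fun x hx h => by
      rw [mem_singleton_iff] at h; subst h; exact hf.zero_notMem hx)
  have hr : ∀ k : ℕ, 0 < δ / ((k : ℝ) + 1) := fun k => by positivity
  let ρ : ℕ → ContDiffBump (0 : Euc n) := fun k =>
    ⟨δ / ((k : ℝ) + 1) / 2, δ / ((k : ℝ) + 1), half_pos (hr k), half_lt_self (hr k)⟩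
  have hρ : Tendsto (fun k => (ρ k).rOut) atTop (𝓝 0) :=
    tendsto_const_nhds.div_atTop
      (tendsto_atTop_add_const_right _ _ tendsto_natCast_atTop_atTop)
  have hf1 : ∀ i, IsTest 1 (pd i f) := fun i =>
    IsTest.pd (k := 1) (by simpa [one_add_one_eq_two] using hf) i
  have hf2 : ∀ i, IsTest 0 (pd i (pd i f)) := fun i =>
    IsTest.pd (k := 0) (by simpa using hf1 i) i
  have hsm : ∀ k, ContDiff ℝ (⊤ : ℕ∞) ((ρ k).normed volume ⋆[lsmul ℝ ℝ, volume] f) := fun k =>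
    (ρ k).hasCompactSupport_normed.contDiff_convolution_left _ (ρ k).contDiff_normed
      hf.contDiff.continuous.locallyIntegrable
  have hlap : ∀ k x, lap ((ρ k).normed volume ⋆[lsmul ℝ ℝ, volume] f) x =
      ∑ i, ((ρ k).normed volume ⋆[lsmul ℝ ℝ, volume] pd i (pd i f)) x := by
    intro k x
    rw [lap_eq_sum_pd ((hsm k).contDiffAt.of_le two_le_infty)]
    refine Finset.sum_congr rfl fun i _ => ?_
    rw [pd_normed_convolution _ (hf.contDiff.of_le (by norm_num)) hf.hasCompactSupport,
      pd_normed_convolution _ (hf1 i).contDiff (hf1 i).hasCompactSupport]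
  obtain ⟨M₀, hM₀⟩ := hf.hasCompactSupport.exists_bound_of_continuous hf.contDiff.continuous
  choose M₂ hM₂ using fun i =>
    (hf2 i).hasCompactSupport.exists_bound_of_continuous (hf2 i).contDiff.continuous
  refine ⟨fun k => (ρ k).normed volume ⋆[lsmul ℝ ℝ, volume] f, cthickening δ (tsupport f),
    max M₀ (∑ i, M₂ i), hf.hasCompactSupport.isCompact.cthickening, fun h => hK h rfl, hsm,
    fun k => ?_, fun k x => ?_, fun k x => ?_, fun x => ?_, fun x => ?_⟩
  · refine closure_minimal ((support_convolution_subset _).trans ?_) isClosed_cthickening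
    rintro _ ⟨y, hy, z, hz, rfl⟩
    rw [(ρ k).support_normed_eq, mem_ball, dist_zero_right] at hy
    refine mem_cthickening_of_dist_le _ z δ _ (subset_tsupport _ hz) ?_
    rw [dist_eq_norm]
    simp only [add_sub_cancel_right]
    exact hy.le.trans (div_le_self hδ.le (by linarith [(Nat.cast_nonneg k : (0 : ℝ) ≤ k)]))
  · exact (abs_normed_convolution_le _ hf.contDiff.continuous hM₀ x).trans (le_max_left _ _)
  · rw [hlap]
    exact ((Finset.abs_sum_le_sum_abs _ _).trans (Finset.sum_le_sum fun i _ =>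
      abs_normed_convolution_le _ (hf2 i).contDiff.continuous (hM₂ i) x)).trans (le_max_right _ _)
  · exact ContDiffBump.convolution_tendsto_right_of_continuous hρ hf.contDiff.continuous x
  · simp only [hlap]
    rw [lap_eq_sum_pd hf.contDiff.contDiffAt]
    exact tendsto_finsetSum _ fun i _ =>
      ContDiffBump.convolution_tendsto_right_of_continuous hρ (hf2 i).contDiff.continuous x

end Mollification

open scoped Topology in
lemma tendsto_integral_mul_of_bounded {n : ℕ} {w f : Euc n → ℝ} {F : ℕ → Euc n → ℝ}
    {K : Set (Euc n)} {W M : ℝ} (hw : AEStronglyMeasurable w) (hK : IsCompact K)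
    (hW : ∀ x ∈ K, |w x| ≤ W) (hF : ∀ k, Continuous (F k)) (hM : ∀ k x, |F k x| ≤ M)
    (hs : ∀ k, ∀ x ∉ K, F k x = 0) (hlim : ∀ x, Tendsto (fun k => F k x) atTop (𝓝 (f x))) :
    Tendsto (fun k => ∫ x, w x * F k x) atTop (𝓝 (∫ x, w x * f x)) := by
  refine tendsto_integral_of_dominated_convergence (K.indicator fun _ => W * M)
    (fun k => hw.mul (hF k).aestronglyMeasurable)
    ((integrable_indicator_iff hK.measurableSet).2 (integrableOn_const hK.measure_ne_top))
    (fun k => Eventually.of_forall fun x => ?_)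
    (Eventually.of_forall fun x => (hlim x).const_mul _)
  by_cases hx : x ∈ K
  · rw [indicator_of_mem hx, norm_mul]
    exact mul_le_mul (hW x hx) (hM k x) (abs_nonneg _) ((abs_nonneg _).trans (hW x hx))
  · rw [indicator_of_notMem hx, hs k x hx, mul_zero, norm_zero]

/-- The stability inequality extends to `C²` test functions. -/
lemma Stable2.le_of_isTest {n m : ℕ} (hn : 1 ≤ n) {p : ℝ} (hp : 1 < p)
    {u : Euc n → EuclideanSpace ℝ (Fin m)}
    (hu : ContinuousOn u {(0 : Euc n)}ᶜ) (hstab : Stable2 n m p u {(0 : Euc n)}ᶜ)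
    {φ : Fin m → Euc n → ℝ} (hφ : ∀ i, IsTest 2 (φ i)) :
    (∑ i, ∫ x, ‖u x‖ ^ (p - 1) * (φ i x) ^ 2) +
      (p - 1) * ∑ i, ∑ j, ∫ x, ‖u x‖ ^ (p - 3) * u x i * u x j * φ i x * φ j x
      ≤ ∑ i, ∫ x, (lap (φ i) x) ^ 2 := by
  have : Nontrivial (Euc n) :=
    Module.nontrivial_of_finrank_pos (R := ℝ) (by rw [finrank_euclideanSpace_fin]; omega)
  choose F K M hK hK0 hsm hsupp hM hML hlim hlimL using fun i => exists_smooth_approx (hφ i)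
  have hum : AEMeasurable u := by
    have := hu.aemeasurable (μ := volume) (measurableSet_singleton _).compl
    rwa [restrict_compl_singleton] at this
  have huim : ∀ i, AEMeasurable fun x => u x i := fun i =>
    (EuclideanSpace.proj (𝕜 := ℝ) i).continuous.measurable.comp_aemeasurable hum
  have hbound : ∀ i, ∃ W, ∀ x ∈ K i, |‖u x‖ ^ (p - 1)| ≤ W := fun i =>
    (hK i).exists_bound_of_continuousOn (f := fun x => ‖u x‖ ^ (p - 1))
      ((hu.norm.rpow_const fun _ _ => Or.inr (by linarith)).mono
        fun x hx h => by rw [mem_singleton_iff] at h; subst h; exact hK0 i hx)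
  choose W hW using hbound
  have hW2 : ∀ i j, ∀ x ∈ K i, |‖u x‖ ^ (p - 3) * u x i * u x j| ≤ W i := by
    intro i j x hx
    refine le_trans ?_ (hW i x hx)
    rcases eq_or_ne (u x) 0 with h0 | h0
    · simp [h0]
    have hpos := norm_pos_iff.2 h0
    have e : ‖u x‖ ^ (p - 1) = ‖u x‖ ^ (p - 3) * ‖u x‖ * ‖u x‖ := by
      rw [mul_assoc, ← pow_two, ← Real.rpow_natCast, ← Real.rpow_add hpos]
      congr 1; push_cast; ring
    rw [e, abs_mul, abs_mul, abs_mul, abs_mul, abs_norm]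
    have h1 : |u x i| ≤ ‖u x‖ := PiLp.norm_apply_le (u x) i
    have h2 : |u x j| ≤ ‖u x‖ := PiLp.norm_apply_le (u x) j
    gcongr
  have hzero : ∀ i k, ∀ x ∉ K i, F i k x = 0 := fun i k x hx =>
    image_eq_zero_of_notMem_tsupport fun h => hx (hsupp i k h)
  have hlapc : ∀ i k, Continuous (lap (F i k)) := fun i k =>
    continuous_iff_continuousAt.2 fun x =>
      (ContDiffAt.lap (k := 0) (by
        simpa [one_add_one_eq_two] using (hsm i k).contDiffAt.of_le two_le_infty)).continuousAt
  have hlapz : ∀ i k, ∀ x ∉ K i, lap (F i k) x = 0 := by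
    intro i k x hx
    have h := notMem_tsupport_iff_eventuallyEq.1 (fun h => hx (hsupp i k h))
    have h2 := h.iteratedFDeriv ℝ 2 |>.self_of_nhds
    simp only [lap, h2]
    simp
  have hsq : ∀ {a b : ℝ}, |a| ≤ b → |a ^ 2| ≤ b ^ 2 := fun {a b} h => by
    rw [abs_pow]; gcongr
  have key := fun k => hstab (fun i => F i k) (fun i => hsm i k)
    (fun i => (hK i).of_isClosed_subset (isClosed_tsupport _) (hsupp i k))
    (fun i => (hsupp i k).trans fun x hx h => by
      rw [mem_singleton_iff] at h; subst h; exact hK0 i hx)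
  refine le_of_tendsto_of_tendsto' (b := atTop) (Tendsto.add ?_ (Tendsto.const_mul _ ?_)) ?_ key
  · refine tendsto_finsetSum _ fun i _ => ?_
    exact tendsto_integral_mul_of_bounded (hum.norm.pow_const _).aestronglyMeasurable (hK i)
      (hW i) (fun k => (hsm i k).continuous.pow 2) (fun k x => hsq (hM i k x))
      (fun k x hx => by simp [hzero i k x hx]) (fun x => (hlim i x).pow 2)
  · refine tendsto_finsetSum _ fun i _ => tendsto_finsetSum _ fun j _ => ?_
    have := tendsto_integral_mul_of_bounded (M := M i * M j) (F := fun k x => F i k x * F j k x)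
      (((hum.norm.pow_const (p - 3)).mul (huim i)).mul (huim j)).aestronglyMeasurable (hK i)
      (hW2 i j) (fun k => (hsm i k).continuous.mul (hsm j k).continuous)
      (fun k x => by
        rw [abs_mul]
        exact mul_le_mul (hM i k x) (hM j k x) (abs_nonneg _) ((abs_nonneg _).trans (hM i k x)))
      (fun k x hx => by simp [hzero i k x hx]) (fun x => (hlim i x).mul (hlim j x))
    simpa only [Pi.mul_apply, mul_assoc] using this
  · refine tendsto_finsetSum _ fun i _ => ?_
    have := tendsto_integral_mul_of_bounded (w := fun _ => (1 : ℝ)) (W := 1)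
      (F := fun k x => lap (F i k) x ^ 2)
      aestronglyMeasurable_const (hK i)
      (by simp) (fun k => (hlapc i k).pow 2) (fun k x => hsq (hML i k x))
      (fun k x hx => by simp [hlapz i k x hx]) (fun x => (hlimL i x).pow 2)
    simpa only [one_mul] using this

/-! ### Integral identities on the sphere -/

section SphereIdentities

variable {n : ℕ}

lemma integrable_sphere {w : Euc n → ℝ} (hw : ∀ x : Euc n, x ≠ 0 → ContDiffAt ℝ 0 w x) :
    Integrable (fun y : sphere (0 : Euc n) 1 => w y)
      (volume : Measure (Euc n)).toSphere := by
  have hc : Continuous fun y : sphere (0 : Euc n) 1 => w y :=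
    continuous_iff_continuousAt.2 fun y =>
      (hw y (ne_zero_of_mem_unit_sphere y)).continuousAt.comp continuousAt_subtype_val
  exact hc.integrable_of_hasCompactSupport (HasCompactSupport.of_compactSpace _)

/-- There is a smooth bump function on the line. -/
lemma exists_bump : ∃ ζ : ℝ → ℝ, ContDiff ℝ (⊤ : ℕ∞) ζ ∧ HasCompactSupport ζ ∧
    0 < ∫ t, ζ t ∧ 0 < ∫ t, ζ t ^ 2 := by
  let b : ContDiffBump (0 : ℝ) := ⟨1, 2, one_pos, one_lt_two⟩
  refine ⟨b, b.contDiff, b.hasCompactSupport, b.integral_pos, ?_⟩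
  refine Continuous.integral_pos_of_hasCompactSupport_nonneg_nonzero (x := 0)
    (b.continuous.pow 2) ?_ (fun t => sq_nonneg _) ?_
  · simp only [pow_two]
    exact b.hasCompactSupport.mul_left (f := b)
  · have : b 0 = 1 := b.one_of_mem_closedBall (by simp [b])
    simp [this]

variable {α : ℝ} {v : Euc n → ℝ}

lemma homogeneous_mul {w : Euc n → ℝ} {δ δ' : ℝ}
    (hv : ∀ t : ℝ, 0 < t → ∀ x : Euc n, x ≠ 0 → v (t • x) = t ^ δ * v x)
    (hw : ∀ t : ℝ, 0 < t → ∀ x : Euc n, x ≠ 0 → w (t • x) = t ^ δ' * w x) :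
    ∀ t : ℝ, 0 < t → ∀ x : Euc n, x ≠ 0 →
      v (t • x) * w (t • x) = t ^ (δ + δ') * (v x * w x) := by
  intro t ht x hx
  rw [hv t ht x hx, hw t ht x hx, Real.rpow_add ht]
  ring

lemma ae_ne_zero (hn : 1 ≤ n) : ∀ᵐ x : Euc n, x ≠ 0 := by
  have : Nontrivial (Euc n) :=
    Module.nontrivial_of_finrank_pos (R := ℝ) (by rw [finrank_euclideanSpace_fin]; omega)
  exact Measure.ae_ne volume 0

lemma contDiffAt_lap_two (hv : ∀ x : Euc n, x ≠ 0 → ContDiffAt ℝ 4 v x) :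
    ∀ x : Euc n, x ≠ 0 → ContDiffAt ℝ 2 (lap v) x := fun x hx =>
  ContDiffAt.lap (k := 2) (by
    have : (2 + 1 + 1 : WithTop ℕ∞) = 4 := by norm_num
    rw [this]; exact hv x hx)

/-- Pairing the bilaplacian of a homogeneous function with the function itself. -/
lemma sphereIntegral_mul_lap_lap (hn : 1 ≤ n)
    (hv : ∀ x : Euc n, x ≠ 0 → ContDiffAt ℝ 4 v x)
    (hhom : ∀ t : ℝ, 0 < t → ∀ x : Euc n, x ≠ 0 → v (t • x) = t ^ (-α) * v x) :
    sphereIntegral (fun x => v x * lap (lap v) x) =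
      sphereIntegral (fun x => lap v x * lap v x) -
        2 * (n - 4 - 2 * α) * sphereIntegral (fun x => v x * lap v x) := by
  obtain ⟨ζ, hζ, hc, hpos, -⟩ := exists_bump
  have hv2 : ∀ x : Euc n, x ≠ 0 → ContDiffAt ℝ 2 v x := fun x hx =>
    (hv x hx).of_le (by norm_num)
  have hl2 := contDiffAt_lap_two hv
  have hhl := lap_homogeneous hv2 hhom
  have hhll := lap_homogeneous hl2 hhl
  set γ : ℝ := 2 * α + 4 - n with hγ
  have hh : IsTest 2 (radial (n := n) γ ζ) := (isTest_radial γ hζ hc).of_le two_le_infty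
  have key := (hh.mul_right hv2).integral_mul_lap hl2
  have e1 : ∫ x, radial γ ζ x * v x * lap (lap v) x =
      sphereIntegral (fun x => v x * lap (lap v) x) * ∫ t, ζ t := by
    simp only [mul_assoc]
    exact integral_radial_mul hn ζ (homogeneous_mul hhom hhll) (by rw [hγ]; ring)
  have e2 : ∫ x, lap (fun y => radial γ ζ y * v y) x * lap v x =
      sphereIntegral (fun x => lap v x * lap v x) * (∫ t, ζ t) +
      sphereIntegral (fun x => v x * lap v x) *
        ∫ t, eulerOp (n + γ - 2 + 2 * -α) (eulerOp γ ζ) t := by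
    rw [← integral_radial_mul hn ζ (γ := γ) (w := fun x => lap v x * lap v x)
        (homogeneous_mul hhl hhl) (by rw [hγ]; ring),
      ← integral_radial_mul hn (eulerOp (n + γ - 2 + 2 * -α) (eulerOp γ ζ)) (γ := γ - 2)
        (w := fun x => v x * lap v x) (homogeneous_mul hhom hhl) (by rw [hγ]; ring), ← integral_add]
    · refine integral_congr_ae ?_
      filter_upwards [ae_ne_zero hn] with x hx
      rw [lap_radial_mul hζ hx (hv2 x hx)
        (euler_identity ((hv2 x hx).differentiableAt (by norm_num)) fun t ht => hhom t ht x hx)]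
      ring
    · exact hh.integrable_mul fun x hx =>
        ((hl2 x hx).mul (hl2 x hx)).of_le zero_le
    · exact (isTest_radial _ hζ.eulerOp.eulerOp hc.eulerOp.eulerOp).integrable_mul fun x hx =>
        ((hv2 x hx).mul (hl2 x hx)).of_le zero_le
  rw [e1, e2, integral_eulerOp hζ.eulerOp hc.eulerOp, integral_eulerOp hζ hc] at key
  refine mul_right_cancel₀ hpos.ne' (key.trans ?_)
  rw [hγ]
  ring

/-- The spectral bound for the Laplacian of a homogeneous function. -/
lemma sphereIntegral_mul_lap_le (hn : 1 ≤ n)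
    (hv : ∀ x : Euc n, x ≠ 0 → ContDiffAt ℝ 2 v x)
    (hhom : ∀ t : ℝ, 0 < t → ∀ x : Euc n, x ≠ 0 → v (t • x) = t ^ (-α) * v x) :
    sphereIntegral (fun x => v x * lap v x) ≤
      -(α * (n - 2 - α)) * sphereIntegral (fun x => v x * v x) := by
  obtain ⟨ζ, hζ, hc, hpos, -⟩ := exists_bump
  have hhl := lap_homogeneous hv hhom
  have hl0 : ∀ x : Euc n, x ≠ 0 → ContDiffAt ℝ 0 (lap v) x := fun x hx =>
    ContDiffAt.lap (k := 0) (by simpa [one_add_one_eq_two] using hv x hx)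
  have hv0 : ∀ x : Euc n, x ≠ 0 → ContDiffAt ℝ 0 v x := fun x hx => (hv x hx).of_le zero_le
  have hp0 : ∀ x : Euc n, x ≠ 0 → ContDiffAt ℝ 0 (fun y => ∑ i, pd i v y * pd i v y) x :=
    fun x hx => ContDiffAt.sum fun i _ =>
      (((hv x hx).pd_one i).mul ((hv x hx).pd_one i)).of_le zero_le
  have hhp : ∀ t : ℝ, 0 < t → ∀ x : Euc n, x ≠ 0 →
      ∑ i, pd i v (t • x) * pd i v (t • x) =
        t ^ (-α - 1 + (-α - 1)) * ∑ i, pd i v x * pd i v x := fun t ht x hx => by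
    rw [Finset.mul_sum]
    exact Finset.sum_congr rfl fun i _ =>
      homogeneous_mul (pd_homogeneous hhom i) (pd_homogeneous hhom i) t ht x hx
  set γ : ℝ := 2 * α + 2 - n with hγ
  have hh : IsTest 2 (radial (n := n) γ ζ) := (isTest_radial γ hζ hc).of_le two_le_infty
  have key := hh.integral_mul_lap (h := fun x => v x * v x) fun x hx => (hv x hx).mul (hv x hx)
  have e1 : ∫ x, radial γ ζ x * lap (fun y => v y * v y) x =
      2 * (sphereIntegral (fun x => v x * lap v x) * ∫ t, ζ t) +
      2 * (sphereIntegral (fun x => ∑ i, pd i v x * pd i v x) * ∫ t, ζ t) := by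
    rw [← integral_radial_mul hn ζ (γ := γ) (homogeneous_mul hhom hhl) (by rw [hγ]; ring),
      ← integral_radial_mul hn ζ (γ := γ) hhp (by rw [hγ]; ring),
      ← integral_const_mul, ← integral_const_mul, ← integral_add]
    · refine integral_congr_ae ?_
      filter_upwards [ae_ne_zero hn] with x hx
      rw [lap_mul (hv x hx) (hv x hx)]
      ring
    · exact (hh.integrable_mul fun x hx => (hv0 x hx).mul (hl0 x hx)).const_mul 2
    · exact (hh.integrable_mul hp0).const_mul 2
  have e2 : ∫ x, lap (radial γ ζ) x * (v x * v x) = sphereIntegral (fun x => v x * v x) *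
        ∫ t, eulerOp (n + γ - 2) (eulerOp γ ζ) t := by
    rw [← integral_radial_mul hn (eulerOp (n + γ - 2) (eulerOp γ ζ)) (γ := γ - 2)
        (homogeneous_mul hhom hhom) (by rw [hγ]; ring)]
    refine integral_congr_ae ?_
    filter_upwards [ae_ne_zero hn] with x hx
    rw [lap_radial hζ hx]
  rw [e1, e2, integral_eulerOp hζ.eulerOp hc.eulerOp, integral_eulerOp hζ hc] at key
  have hgrad : α ^ 2 * sphereIntegral (fun x => v x * v x) ≤
      sphereIntegral (fun x => ∑ i, pd i v x * pd i v x) := by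
    rw [sphereIntegral, sphereIntegral, ← integral_const_mul]
    refine integral_mono ((integrable_sphere fun x hx => (hv0 x hx).mul (hv0 x hx)).const_mul _)
      (integrable_sphere hp0) fun y => ?_
    have hy := ne_zero_of_mem_unit_sphere y
    have he := euler_identity ((hv y hy).differentiableAt (by norm_num))
      fun t ht => hhom t ht y hy
    have hcs := Finset.sum_mul_sq_le_sq_mul_sq Finset.univ (fun i => (y : Euc n) i)
      (fun i => pd i v y)
    have hy1 : ∑ i, (y : Euc n) i ^ 2 = 1 := by
      rw [← EuclideanSpace.real_norm_sq_eq, norm_eq_of_mem_sphere y, one_pow]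
    rw [he, hy1, one_mul] at hcs
    simp only [← pow_two]
    linarith
  have key' : 2 * sphereIntegral (fun x => v x * lap v x) +
      2 * sphereIntegral (fun x => ∑ i, pd i v x * pd i v x) =
      2 * α * γ * sphereIntegral (fun x => v x * v x) := by
    refine mul_right_cancel₀ hpos.ne' (Eq.trans (by ring) (key.trans ?_))
    rw [hγ]
    ring
  rw [hγ] at key'
  linarith

lemma sphereIntegral_sq_nonneg (hv : ∀ x : Euc n, x ≠ 0 → ContDiffAt ℝ 2 v x) (a : ℝ) :
    0 ≤ sphereIntegral (fun x => lap v x * lap v x) +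
      2 * a * sphereIntegral (fun x => v x * lap v x) +
      a ^ 2 * sphereIntegral (fun x => v x * v x) := by
  have hl0 : ∀ x : Euc n, x ≠ 0 → ContDiffAt ℝ 0 (lap v) x := fun x hx =>
    ContDiffAt.lap (k := 0) (by simpa [one_add_one_eq_two] using hv x hx)
  have hv0 : ∀ x : Euc n, x ≠ 0 → ContDiffAt ℝ 0 v x := fun x hx => (hv x hx).of_le zero_le
  have i1 := integrable_sphere fun x hx => (hl0 x hx).mul (hl0 x hx)
  have i2 := (integrable_sphere fun x hx => (hv0 x hx).mul (hl0 x hx)).const_mul (2 * a)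
  have i3 := (integrable_sphere fun x hx => (hv0 x hx).mul (hv0 x hx)).const_mul (a ^ 2)
  simp only [sphereIntegral]
  rw [← integral_const_mul, ← integral_const_mul, ← integral_add i1 i2,
    ← integral_add (by exact i1.add i2) i3]
  refine integral_nonneg fun y => ?_
  have := sq_nonneg (lap v y + a * v y)
  simp only [Pi.zero_apply]
  linarith

end SphereIdentities

/-! ### The stability inequality on the sphere -/

lemma integral_lap_radial_mul_sq {n : ℕ} (hn : 1 ≤ n) {α : ℝ} {v : Euc n → ℝ}
    (hv : ∀ x : Euc n, x ≠ 0 → ContDiffAt ℝ 2 v x)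
    (hhom : ∀ t : ℝ, 0 < t → ∀ x : Euc n, x ≠ 0 → v (t • x) = t ^ (-α) * v x)
    {η ξ : ℝ → ℝ} (hη : ContDiff ℝ (⊤ : ℕ∞) η) (hc : HasCompactSupport η)
    (hξ : ξ = eulerOp (n / 2 - α) (eulerOp (α - (n - 4) / 2) η)) :
    ∫ x, lap (fun y => radial (α - (n - 4) / 2) η y * v y) x ^ 2 =
      sphereIntegral (fun x => lap v x * lap v x) * (∫ t, η t * η t) +
      2 * (sphereIntegral (fun x => v x * lap v x) * ∫ t, η t * ξ t) +
      sphereIntegral (fun x => v x * v x) * ∫ t, ξ t * ξ t := by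
  have hhl := lap_homogeneous hv hhom
  have hl0 : ∀ x : Euc n, x ≠ 0 → ContDiffAt ℝ 0 (lap v) x := fun x hx =>
    ContDiffAt.lap (k := 0) (by simpa [one_add_one_eq_two] using hv x hx)
  have hv0 : ∀ x : Euc n, x ≠ 0 → ContDiffAt ℝ 0 v x := fun x hx => (hv x hx).of_le zero_le
  have hξs : ContDiff ℝ (⊤ : ℕ∞) ξ := hξ ▸ hη.eulerOp.eulerOp
  have hξc : HasCompactSupport ξ := hξ ▸ hc.eulerOp.eulerOp
  set γ : ℝ := α - (n - 4) / 2 with hγ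
  rw [← integral_radial_mul hn (fun t => η t * η t) (γ := γ + γ)
      (w := fun x => lap v x * lap v x) (homogeneous_mul hhl hhl) (by rw [hγ]; ring),
    ← integral_radial_mul hn (fun t => η t * ξ t) (γ := γ + (γ - 2))
      (w := fun x => v x * lap v x) (homogeneous_mul hhom hhl) (by rw [hγ]; ring),
    ← integral_radial_mul hn (fun t => ξ t * ξ t) (γ := (γ - 2) + (γ - 2))
      (w := fun x => v x * v x) (homogeneous_mul hhom hhom) (by rw [hγ]; ring)]
  have i1 := (isTest_radial (γ + γ) (hη.mul hη) hc.mul_right).integrable_mul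
    fun x hx => (hl0 x hx).mul (hl0 x hx)
  have i2 := ((isTest_radial (γ + (γ - 2)) (hη.mul hξs) hc.mul_right).integrable_mul
    fun x hx => (hv0 x hx).mul (hl0 x hx)).const_mul 2
  have i3 := (isTest_radial (γ - 2 + (γ - 2)) (hξs.mul hξs) hξc.mul_right).integrable_mul
    fun x hx => (hv0 x hx).mul (hv0 x hx)
  rw [← integral_const_mul, ← integral_add i1 i2, ← integral_add (by exact i1.add i2) i3]
  refine integral_congr_ae ?_
  filter_upwards [ae_ne_zero hn] with x hx
  have hcoef : (n : ℝ) + γ - 2 + 2 * -α = n / 2 - α := by rw [hγ]; ring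
  rw [lap_radial_mul hη hx (hv x hx)
    (euler_identity ((hv x hx).differentiableAt (by norm_num)) fun t ht => hhom t ht x hx),
    hcoef, ← hξ]
  simp only [← radial_mul_radial]
  ring

lemma rpow_norm_mul_sum_sq {m : ℕ} {p : ℝ} (hp : 1 < p) (z : EuclideanSpace ℝ (Fin m)) :
    ‖z‖ ^ (p - 3) * ∑ j, z j ^ 2 = ‖z‖ ^ (p - 1) := by
  rw [← EuclideanSpace.real_norm_sq_eq]
  rcases eq_or_ne z 0 with rfl | h0
  · rw [norm_zero, Real.zero_rpow (by linarith : p - 1 ≠ 0)]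
    simp
  · rw [← Real.rpow_natCast, ← Real.rpow_add (norm_pos_iff.2 h0)]
    congr 1
    push_cast
    ring

section Stability

variable {n m : ℕ} {p α : ℝ} {u : Euc n → EuclideanSpace ℝ (Fin m)}

/-- The stability inequality tested against `|x|^γ η(log |x|) u`. -/
lemma Stable2.profile_le (hn : 1 ≤ n) (hp : 1 < p) (hα : α * (p - 1) = 4)
    (hreg : ∀ i, ∀ x : Euc n, x ≠ 0 → ContDiffAt ℝ 4 (fun y => u y i) x)
    (hhom : ∀ t : ℝ, 0 < t → ∀ x : Euc n, u (t • x) = t ^ (-α) • u x)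
    (hsol : ∀ (i : Fin m), ∀ x : Euc n, x ≠ 0 →
      lap (lap fun w => u w i) x = ‖u x‖ ^ (p - 1) * u x i)
    (hcont : ContinuousOn u {(0 : Euc n)}ᶜ)
    (hstab : Stable2 n m p u {(0 : Euc n)}ᶜ)
    {η ξ : ℝ → ℝ} (hη : ContDiff ℝ (⊤ : ℕ∞) η) (hc : HasCompactSupport η)
    (hξ : ξ = eulerOp (n / 2 - α) (eulerOp (α - (n - 4) / 2) η)) :
    p * (∑ i, sphereIntegral fun x => u x i * lap (lap fun w => u w i) x) * (∫ t, η t * η t) ≤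
      (∑ i, sphereIntegral fun x => lap (fun w => u w i) x * lap (fun w => u w i) x) *
        (∫ t, η t * η t) +
      2 * ((∑ i, sphereIntegral fun x => u x i * lap (fun w => u w i) x) * ∫ t, η t * ξ t) +
      (∑ i, sphereIntegral fun x => u x i * u x i) * ∫ t, ξ t * ξ t := by
  have hv2 : ∀ i, ∀ x : Euc n, x ≠ 0 → ContDiffAt ℝ 2 (fun y => u y i) x := fun i x hx =>
    (hreg i x hx).of_le (by norm_num)
  have hhomi : ∀ i, ∀ t : ℝ, 0 < t → ∀ x : Euc n, x ≠ 0 →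
      u (t • x) i = t ^ (-α) * u x i := fun i t ht x _ => by rw [hhom t ht x]; simp
  have hll0 : ∀ i, ∀ x : Euc n, x ≠ 0 → ContDiffAt ℝ 0 (lap (lap fun w => u w i)) x :=
    fun i x hx => ContDiffAt.lap (k := 0) (by
      simpa [one_add_one_eq_two] using contDiffAt_lap_two (hreg i) x hx)
  have hhll := fun i => lap_homogeneous (contDiffAt_lap_two (hreg i))
    (lap_homogeneous (hv2 i) (hhomi i))
  set γ : ℝ := α - (n - 4) / 2 with hγ
  have hle := hstab.le_of_isTest hn hp hcont (φ := fun i x => radial γ η x * u x i)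
    fun i => ((isTest_radial γ hη hc).of_le two_le_infty).mul_right (hv2 i)
  have e1 : ∀ i, ∫ x, ‖u x‖ ^ (p - 1) * (radial γ η x * u x i) ^ 2 =
      (sphereIntegral fun x => u x i * lap (lap fun w => u w i) x) * ∫ t, η t * η t := by
    intro i
    rw [← integral_radial_mul hn (fun t => η t * η t) (γ := γ + γ)
      (δ := -α + (-α - 2 - 2)) (w := fun x => u x i * lap (lap fun w => u w i) x)
      (homogeneous_mul (v := fun x => u x i) (hhomi i) (hhll i))
      (by rw [hγ]; ring)]
    refine integral_congr_ae ?_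
    filter_upwards [ae_ne_zero hn] with x hx
    rw [hsol i x hx, ← radial_mul_radial]
    ring
  have e2 : ∀ i j, ∫ x, ‖u x‖ ^ (p - 3) * u x i * u x j * (radial γ η x * u x i) *
        (radial γ η x * u x j) =
      (sphereIntegral fun x => ‖u x‖ ^ (p - 3) * (u x i * u x i * (u x j * u x j))) *
        ∫ t, η t * η t := by
    intro i j
    have hnorm : ∀ t : ℝ, 0 < t → ∀ x : Euc n, x ≠ 0 →
        ‖u (t • x)‖ ^ (p - 3) = t ^ (-α * (p - 3)) * ‖u x‖ ^ (p - 3) := fun t ht x _ => by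
      rw [hhom t ht x, norm_smul, Real.norm_of_nonneg (Real.rpow_nonneg ht.le _),
        Real.mul_rpow (Real.rpow_nonneg ht.le _) (norm_nonneg _), ← Real.rpow_mul ht.le]
    have hsq : ∀ k, ∀ t : ℝ, 0 < t → ∀ x : Euc n, x ≠ 0 →
        u (t • x) k * u (t • x) k = t ^ (-α + -α) * (u x k * u x k) := fun k =>
      homogeneous_mul (v := fun x => u x k) (w := fun x => u x k) (hhomi k) (hhomi k)
    rw [← integral_radial_mul hn (fun t => η t * η t) (γ := γ + γ)
      (δ := -α * (p - 3) + (-α + -α + (-α + -α)))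
      (w := fun x => ‖u x‖ ^ (p - 3) * (u x i * u x i * (u x j * u x j)))
      (homogeneous_mul (v := fun x => ‖u x‖ ^ (p - 3))
        (w := fun x => u x i * u x i * (u x j * u x j)) hnorm
        (homogeneous_mul (v := fun x => u x i * u x i) (w := fun x => u x j * u x j)
          (hsq i) (hsq j))) (by rw [hγ]; linarith)]
    refine integral_congr_ae (Eventually.of_forall fun x => ?_)
    simp only [← radial_mul_radial]
    ring
  have hpt : ∀ i, ∀ x : Euc n, x ≠ 0 →
      ∑ j, ‖u x‖ ^ (p - 3) * (u x i * u x i * (u x j * u x j)) =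
        u x i * lap (lap fun w => u w i) x := by
    intro i x hx
    rw [hsol i x hx, ← rpow_norm_mul_sum_sq hp, Finset.mul_sum, Finset.sum_mul, Finset.mul_sum]
    exact Finset.sum_congr rfl fun j _ => by ring
  have hucont : Continuous fun y : sphere (0 : Euc n) 1 => u y :=
    hcont.comp_continuous continuous_subtype_val fun y => ne_zero_of_mem_unit_sphere y
  have hmeas : ∀ i, Measurable fun y : sphere (0 : Euc n) 1 => u y i := fun i =>
    ((EuclideanSpace.proj (𝕜 := ℝ) i).continuous.comp hucont).measurable
  have e3 : ∀ i, ∑ j, (sphereIntegral fun x =>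
      ‖u x‖ ^ (p - 3) * (u x i * u x i * (u x j * u x j))) =
      sphereIntegral fun x => u x i * lap (lap fun w => u w i) x := by
    intro i
    simp only [sphereIntegral]
    rw [← integral_finsetSum]
    · exact integral_congr_ae (Eventually.of_forall fun y =>
        hpt i y (ne_zero_of_mem_unit_sphere y))
    · intro j _
      refine (integrable_sphere fun x hx => ((hv2 i x hx).of_le zero_le).mul
        (hll0 i x hx)).mono' ?_ (Eventually.of_forall fun y => ?_)
      · exact ((hucont.norm.measurable.pow_const _).mul (((hmeas i).mul (hmeas i)).mul
          ((hmeas j).mul (hmeas j)))).aestronglyMeasurable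
      · have h0 : ∀ k, 0 ≤ ‖u y‖ ^ (p - 3) * (u y i * u y i * (u y k * u y k)) := fun k =>
          mul_nonneg (by positivity) (mul_nonneg (mul_self_nonneg _) (mul_self_nonneg _))
        rw [Real.norm_of_nonneg (h0 j), ← hpt i y (ne_zero_of_mem_unit_sphere y)]
        exact Finset.single_le_sum (fun k _ => h0 k) (Finset.mem_univ j)
  have e4 := fun i => integral_lap_radial_mul_sq hn (hv2 i) (hhomi i) hη hc hξ
  simp only [← hγ] at e4
  simp only [e1, e2, e4, ← Finset.sum_mul, e3] at hle
  simp only [Finset.sum_add_distrib, ← Finset.mul_sum, ← Finset.sum_mul] at hle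
  linarith

end Stability

lemma eulerOp_eulerOp_comp_mul {a b ε : ℝ} {χ : ℝ → ℝ} (hχ : ContDiff ℝ (⊤ : ℕ∞) χ) :
    eulerOp a (eulerOp b fun t => χ (ε * t)) = fun t =>
      a * b * χ (ε * t) + (a + b) * ε * deriv χ (ε * t) + ε ^ 2 * deriv (deriv χ) (ε * t) := by
  have hχ' := (contDiff_infty_iff_deriv.1 hχ).2
  have d : ∀ {f : ℝ → ℝ}, ContDiff ℝ (⊤ : ℕ∞) f → ∀ t,
      HasDerivAt (fun s => f (ε * s)) (ε * deriv f (ε * t)) t := fun {f} hf t => by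
    have h1 := ((hf.differentiable (by simp)) (ε * t)).hasDerivAt
    have h2 : HasDerivAt (fun s : ℝ => ε * s) ε t := by
      simpa using (hasDerivAt_id t).const_mul ε
    exact (h1.comp t h2).congr_deriv (mul_comm _ _)
  have e1 : (eulerOp b fun t => χ (ε * t)) = fun t => b * χ (ε * t) + ε * deriv χ (ε * t) :=
    funext fun t => by rw [eulerOp, (d hχ t).deriv]
  rw [e1]
  funext t
  rw [eulerOp, (((d hχ t).const_mul b).fun_add ((d hχ' t).const_mul ε)).deriv]
  ring

lemma hasCompactSupport_comp_mul {χ : ℝ → ℝ} (hc : HasCompactSupport χ) {ε : ℝ} (hε : ε ≠ 0) :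
    HasCompactSupport fun t => χ (ε * t) :=
  hc.comp_homeomorph (Homeomorph.mulLeft₀ ε hε)

/-- Letting the profile become flat in a quadratic form inequality. -/
lemma le_of_profile_le {P A B C a b κ : ℝ} (hab : a + b = 2) (hκ : a * b = κ)
    (h : ∀ η : ℝ → ℝ, ContDiff ℝ (⊤ : ℕ∞) η → HasCompactSupport η →
      P * (∫ t, η t * η t) ≤ A * (∫ t, η t * η t) +
        2 * (B * ∫ t, η t * eulerOp a (eulerOp b η) t) +
        C * ∫ t, eulerOp a (eulerOp b η) t * eulerOp a (eulerOp b η) t) :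
    P ≤ A + 2 * κ * B + κ ^ 2 * C := by
  obtain ⟨χ, hχ, hc, -, hpos⟩ := exists_bump
  have hχ' := (contDiff_infty_iff_deriv.1 hχ).2
  have hχ'' := (contDiff_infty_iff_deriv.1 hχ').2
  have int : ∀ {f g : ℝ → ℝ}, Continuous f → HasCompactSupport f → Continuous g →
      Integrable fun t => f t * g t := fun hf hfc hg =>
    (hf.mul hg).integrable_of_hasCompactSupport hfc.mul_right
  have i00 := int hχ.continuous hc hχ.continuous
  have i01 := int hχ.continuous hc hχ'.continuous
  have i02 := int hχ.continuous hc hχ''.continuous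
  have i11 := int hχ'.continuous hc.deriv hχ'.continuous
  have i12 := int hχ'.continuous hc.deriv hχ''.continuous
  have i22 := int hχ''.continuous hc.deriv.deriv hχ''.continuous
  set I00 := ∫ t, χ t * χ t with hI00
  set I01 := ∫ t, χ t * deriv χ t with hI01
  set I02 := ∫ t, χ t * deriv (deriv χ) t with hI02
  set I11 := ∫ t, deriv χ t * deriv χ t with hI11
  set I12 := ∫ t, deriv χ t * deriv (deriv χ) t with hI12
  set I22 := ∫ t, deriv (deriv χ) t * deriv (deriv χ) t with hI22
  have key : ∀ ε : ℝ, 0 < ε → P * I00 ≤ A * I00 +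
      2 * (B * (κ * I00 + 2 * ε * I01 + ε ^ 2 * I02)) +
      C * (κ ^ 2 * I00 + 4 * κ * ε * I01 + 2 * κ * ε ^ 2 * I02 + 4 * ε ^ 2 * I11 +
        4 * ε ^ 3 * I12 + ε ^ 4 * I22) := by
    intro ε hε
    have hh := h (fun t => χ (ε * t)) (hχ.comp (contDiff_const.mul contDiff_id))
      (hasCompactSupport_comp_mul hc hε.ne')
    rw [eulerOp_eulerOp_comp_mul hχ, hab, hκ] at hh
    have sc : ∀ f : ℝ → ℝ, ∫ t, f (ε * t) = ε⁻¹ * ∫ t, f t := fun f => by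
      rw [Measure.integral_comp_mul_left f ε, abs_of_pos (inv_pos.2 hε), smul_eq_mul]
    have s1 := sc fun t => χ t * χ t
    have s2 := sc fun t => χ t * (κ * χ t + 2 * ε * deriv χ t + ε ^ 2 * deriv (deriv χ) t)
    have s3 := sc fun t => (κ * χ t + 2 * ε * deriv χ t + ε ^ 2 * deriv (deriv χ) t) *
      (κ * χ t + 2 * ε * deriv χ t + ε ^ 2 * deriv (deriv χ) t)
    have t2 : ∫ t, χ t * (κ * χ t + 2 * ε * deriv χ t + ε ^ 2 * deriv (deriv χ) t) =
        κ * I00 + 2 * ε * I01 + ε ^ 2 * I02 := by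
      rw [hI00, hI01, hI02, ← integral_const_mul, ← integral_const_mul, ← integral_const_mul,
        ← integral_add (i00.const_mul _) (i01.const_mul _),
        ← integral_add (by exact (i00.const_mul _).add (i01.const_mul _)) (i02.const_mul _)]
      exact integral_congr_ae (Eventually.of_forall fun t => by ring)
    have t3 : ∫ t, (κ * χ t + 2 * ε * deriv χ t + ε ^ 2 * deriv (deriv χ) t) *
        (κ * χ t + 2 * ε * deriv χ t + ε ^ 2 * deriv (deriv χ) t) =
        κ ^ 2 * I00 + 4 * κ * ε * I01 + 2 * κ * ε ^ 2 * I02 + 4 * ε ^ 2 * I11 +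
        4 * ε ^ 3 * I12 + ε ^ 4 * I22 := by
      have j1 := (i00.const_mul (κ ^ 2)).add (i01.const_mul (4 * κ * ε))
      have j2 := j1.add (i02.const_mul (2 * κ * ε ^ 2))
      have j3 := j2.add (i11.const_mul (4 * ε ^ 2))
      have j4 := j3.add (i12.const_mul (4 * ε ^ 3))
      rw [hI00, hI01, hI02, hI11, hI12, hI22, ← integral_const_mul, ← integral_const_mul,
        ← integral_const_mul, ← integral_const_mul, ← integral_const_mul, ← integral_const_mul,
        ← integral_add (i00.const_mul _) (i01.const_mul _),
        ← integral_add (by exact j1) (i02.const_mul _),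
        ← integral_add (by exact j2) (i11.const_mul _),
        ← integral_add (by exact j3) (i12.const_mul _),
        ← integral_add (by exact j4) (i22.const_mul _)]
      exact integral_congr_ae (Eventually.of_forall fun t => by ring)
    rw [← hI00] at s1
    rw [t2] at s2
    rw [t3] at s3
    rw [s1, s2, s3] at hh
    have := mul_le_mul_of_nonneg_left hh hε.le
    calc P * I00 = ε * (P * (ε⁻¹ * I00)) := by field_simp
      _ ≤ _ := this
      _ = _ := by field_simp
  have hpos' : 0 < I00 := by simpa only [hI00, ← pow_two] using hpos
  have hlim : P * I00 ≤ A * I00 + 2 * (B * (κ * I00)) + C * (κ ^ 2 * I00) := by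
    have hcont : Continuous fun ε : ℝ => A * I00 +
      2 * (B * (κ * I00 + 2 * ε * I01 + ε ^ 2 * I02)) +
      C * (κ ^ 2 * I00 + 4 * κ * ε * I01 + 2 * κ * ε ^ 2 * I02 + 4 * ε ^ 2 * I11 +
        4 * ε ^ 3 * I12 + ε ^ 4 * I22) := by fun_prop
    have ht := (hcont.tendsto 0).mono_left (nhdsWithin_le_nhds (s := Ioi 0))
    have := ge_of_tendsto ht (eventually_mem_nhdsWithin.mono fun ε hε => key ε hε)
    simpa using this
  refine le_of_mul_le_mul_right ?_ hpos'
  linarith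

lemma eq_zero_of_sphereIntegral_sq_nonpos {n : ℕ} {v : Euc n → ℝ}
    (hv : ∀ x : Euc n, x ≠ 0 → ContDiffAt ℝ 0 v x)
    (h : sphereIntegral (fun x => v x * v x) ≤ 0) (y : sphere (0 : Euc n) 1) : v y = 0 := by
  have hc : Continuous fun y : sphere (0 : Euc n) 1 => v y :=
    continuous_iff_continuousAt.2 fun y =>
      (hv y (ne_zero_of_mem_unit_sphere y)).continuousAt.comp continuousAt_subtype_val
  by_contra hne
  refine h.not_gt (Continuous.integral_pos_of_hasCompactSupport_nonneg_nonzero (x := y)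
    (hc.mul hc) (HasCompactSupport.of_compactSpace _) (fun z => mul_self_nonneg _)
    (mul_self_ne_zero.2 hne))

/-- Theorem 3.4: classification of stable homogeneous solutions of the fourth order
Lane–Emden system.  A homogeneous map `u_i(x) = |x|^{−4/(p−1)} ψ_i(x/|x|)` (with
`ψ = (ψ_i)` of class `C⁴` on the sphere, encoded by `u` being `C⁴` away from the origin
and homogeneous of degree `−4/(p−1)`) which solves `Δ²u_i = |u|^{p−1} u_i` on `ℝⁿ∖{0}`
and is stable with respect to test functions in `C_c^∞(ℝⁿ∖{0})` must vanish
(i.e. `ψ_i ≡ 0` for every `i`), provided `(n+4)/(n−4) < p < q_c(n)`. -/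
theorem statement13 (n m : ℕ) (hn : 5 ≤ n) (hm : 1 ≤ m) (p : ℝ)
    (hp1 : ((n : ℝ) + 4) / ((n : ℝ) - 4) < p)
    (hp2 : 13 ≤ n →
      p < ((n : ℝ) + 2 -
            Real.sqrt ((n : ℝ) ^ 2 + 4 - (n : ℝ) * Real.sqrt ((n : ℝ) ^ 2 - 8 * n + 32))) /
          ((n : ℝ) - 6 -
            Real.sqrt ((n : ℝ) ^ 2 + 4 - (n : ℝ) * Real.sqrt ((n : ℝ) ^ 2 - 8 * n + 32))))
    (u : Euc n → EuclideanSpace ℝ (Fin m))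
    (hreg : ContDiffOn ℝ 4 u {(0 : Euc n)}ᶜ)
    (hhom : ∀ t : ℝ, 0 < t → ∀ x : Euc n, u (t • x) = t ^ (-(4 / (p - 1))) • u x)
    (hsol : ∀ (i : Fin m), ∀ x : Euc n, x ≠ 0 →
      lap (fun z => lap (fun w => u w i) z) x = ‖u x‖ ^ (p - 1) * u x i)
    (hstab : Stable2 n m p u {(0 : Euc n)}ᶜ) :
    ∀ x : Euc n, x ≠ 0 → u x = 0 := by
  obtain ⟨hp, hα', hHR⟩ := hardyRellich_lt n hn p hp1 hp2
  have hn1 : 1 ≤ n := by omega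
  obtain ⟨α, hα⟩ : ∃ α, α = 4 / (p - 1) := ⟨_, rfl⟩
  rw [← hα] at hα' hHR hhom
  have hα0 : 0 < α := hα ▸ div_pos four_pos (sub_pos.2 hp)
  have hαp : α * (p - 1) = 4 := by rw [hα]; exact div_mul_cancel₀ _ (sub_pos.2 hp).ne'
  have hreg' : ∀ i, ∀ x : Euc n, x ≠ 0 → ContDiffAt ℝ 4 (fun y => u y i) x := fun i x hx =>
    (EuclideanSpace.proj (𝕜 := ℝ) i).contDiff.contDiffAt.comp x
      (hreg.contDiffAt (isOpen_compl_singleton.mem_nhds hx))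
  have hv2 : ∀ i, ∀ x : Euc n, x ≠ 0 → ContDiffAt ℝ 2 (fun y => u y i) x := fun i x hx =>
    (hreg' i x hx).of_le (by norm_num)
  have hhomi : ∀ i, ∀ t : ℝ, 0 < t → ∀ x : Euc n, x ≠ 0 →
      u (t • x) i = t ^ (-α) * u x i := fun i t ht x _ => by rw [hhom t ht x]; simp
  have hC : (∑ i, sphereIntegral fun x => u x i * u x i) ≤ 0 := by
    refine nonpos_of_sphere_relations hα0 hα' hp hHR
      (A := ∑ i, sphereIntegral fun x => lap (fun w => u w i) x * lap (fun w => u w i) x)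
      (B := ∑ i, sphereIntegral fun x => u x i * lap (fun w => u w i) x)
      (D := ∑ i, sphereIntegral fun x => u x i * lap (lap fun w => u w i) x) ?_ ?_ ?_ ?_
    · rw [Finset.mul_sum, ← Finset.sum_sub_distrib]
      exact Finset.sum_congr rfl fun i _ => sphereIntegral_mul_lap_lap hn1 (hreg' i) (hhomi i)
    · exact le_of_profile_le (a := n / 2 - α) (b := α - (n - 4) / 2) (by ring) (mul_comm _ _)
        fun η hη hc => hstab.profile_le hn1 hp hαp hreg' hhom hsol hreg.continuousOn hη hc rfl
    · rw [Finset.mul_sum]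
      exact Finset.sum_le_sum fun i _ => sphereIntegral_mul_lap_le hn1 (hv2 i) (hhomi i)
    · rw [Finset.mul_sum, Finset.mul_sum, ← Finset.sum_add_distrib, ← Finset.sum_add_distrib]
      exact Finset.sum_nonneg fun i _ => sphereIntegral_sq_nonneg (hv2 i) _
  intro x hx
  ext i
  have hi : (sphereIntegral fun x => u x i * u x i) ≤ 0 :=
    (Finset.single_le_sum (f := fun i => sphereIntegral fun x => u x i * u x i)
      (fun j _ => integral_nonneg fun y => mul_self_nonneg _) (Finset.mem_univ i)).trans hC
  have hpos := norm_pos_iff.2 hx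
  have h0 := eq_zero_of_sphereIntegral_sq_nonpos (fun x hx => (hv2 i x hx).of_le zero_le) hi
    ⟨‖x‖⁻¹ • x, by simp [norm_smul, hpos.ne']⟩
  have := hhomi i ‖x‖ hpos (‖x‖⁻¹ • x) (smul_ne_zero (inv_ne_zero hpos.ne') hx)
  rw [smul_inv_smul₀ hpos.ne', h0, mul_zero] at this
  simpa using this
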